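/- arXiv:1712.00896 — 2 statements merged into one kernel-verified Lean document; each statement's English description precedes it below -/
import Mathlib

section
/- For every b ∈ ℂ and every n ∈ ℤ², as operators on N: Θ_b(E11(n)) = E11(n) + b q^{m₂n₁} X_{m+n}∘X_m^{−1}, Θ_b(E22(n)) = E22(n) − b q^{m₁n₂} X_{m+n}∘X_m^{−1}, Θ_b(D1) = D1 − b m₁·id, and Θ_b(D2) = D2 − b m₂·id. -/
open MvPolynomial Finsupp

/-- The index set of the variables other than `x_m`. -/
abbrev NVar (m : ℤ × ℤ) := {p : ℤ × ℤ // p ≠ m}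

/-- `N = ℂ[x_m, x_m^{−1}][x_n : n ≠ m]`, realized as finitely supported families,
indexed by the exponent of `x_m` (an arbitrary integer), of polynomials in the
variables `x_n`, `n ≠ m`. -/
abbrev NN (m : ℤ × ℤ) := ℤ →₀ MvPolynomial (NVar m) ℂ

/-- Multiplication by `x_m^j` on `N` (for `j = -1` this is `X_m^{−1}`). -/
noncomputable def XmZ (m : ℤ × ℤ) (j : ℤ) (g : NN m) : NN m :=
  Finsupp.mapDomain (· + j) g

/-- Multiplication by `x_k` on `N` (the operator `X_k`). -/
noncomputable def Xop (m : ℤ × ℤ) (k : ℤ × ℤ) (g : NN m) : NN m :=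
  if h : k = m then XmZ m 1 g
  else Finsupp.mapRange (fun a => X (⟨k, h⟩ : NVar m) * a) (by simp) g

/-- The partial derivative `∂_s` on `N` (with `∂_m x_m^k = k x_m^{k−1}`, `k ∈ ℤ`). -/
noncomputable def Dop (m : ℤ × ℤ) (s : ℤ × ℤ) (g : NN m) : NN m :=
  if h : s = m then g.sum (fun k a => Finsupp.single (k - 1) (k • a))
  else Finsupp.mapRange (fun a => pderiv (⟨s, h⟩ : NVar m) a) (by simp) g

/-- A finite set of indices containing every `s` for which `∂_s` acts nonzero on `g`
(together with `m`); sums over all `s ∈ ℤ²` in the defining formulas reduce to sums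
over this finite set. -/
noncomputable def nvars (m : ℤ × ℤ) (g : NN m) : Finset (ℤ × ℤ) :=
  insert m (g.support.biUnion fun k => (g k).vars.image Subtype.val)

/-- `E21(n)` on `N`: multiplication by `x_n`. -/
noncomputable def E21N (m n : ℤ × ℤ) (g : NN m) : NN m := Xop m n g

/-- `E22(n) = Σ_s q^{s₁n₂} x_{n+s} ∂_s` on `N`. -/
noncomputable def E22N (q : ℂ) (m n : ℤ × ℤ) (g : NN m) : NN m :=
  ∑ s ∈ nvars m g, q ^ (s.1 * n.2) • Xop m (n + s) (Dop m s g)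

/-- `E11(n) = δ_{n,0} μ id − Σ_s q^{s₂n₁} x_{n+s} ∂_s` on `N`. -/
noncomputable def E11N (q μ : ℂ) (m n : ℤ × ℤ) (g : NN m) : NN m :=
  (if n = 0 then μ • g else 0) - ∑ s ∈ nvars m g, q ^ (s.2 * n.1) • Xop m (n + s) (Dop m s g)

/-- `E12(n) = q^{−n₁n₂} μ ∂_{−n} − Σ_{s,r} q^{n₂r₁+s₂n₁+s₂r₁} x_{n+s+r} ∂_s ∂_r` on `N`. -/
noncomputable def E12N (q μ : ℂ) (m n : ℤ × ℤ) (g : NN m) : NN m :=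
  q ^ (-(n.1 * n.2)) • μ • Dop m (-n) g -
    ∑ s ∈ nvars m g, ∑ r ∈ nvars m g,
      q ^ (n.2 * r.1 + s.2 * n.1 + s.2 * r.1) • Xop m (n + s + r) (Dop m s (Dop m r g))

/-- `𝓔_m = Σ_{s,r} q^{−m₂r₁−s₂m₁+s₂r₁} x_{−m+s+r} ∂_s ∂_r` on `N`. -/
noncomputable def EmN (q : ℂ) (m : ℤ × ℤ) (g : NN m) : NN m :=
  ∑ s ∈ nvars m g, ∑ r ∈ nvars m g,
    q ^ (-(m.2 * r.1) - s.2 * m.1 + s.2 * r.1) • Xop m (-m + s + r) (Dop m s (Dop m r g))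

/-- `D1 = Σ_s s₁ x_s ∂_s` on `N`. -/
noncomputable def D1N (m : ℤ × ℤ) (g : NN m) : NN m :=
  ∑ s ∈ nvars m g, (s.1 : ℂ) • Xop m s (Dop m s g)

/-- `D2 = Σ_s s₂ x_s ∂_s` on `N`. -/
noncomputable def D2N (m : ℤ × ℤ) (g : NN m) : NN m :=
  ∑ s ∈ nvars m g, (s.2 : ℂ) • Xop m s (Dop m s g)

/-- `ad(X_m) = [X_m, −]` acting on operators on `N`. -/
noncomputable def adXm (m : ℤ × ℤ) (A : NN m → NN m) : NN m → NN m :=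
  fun g => XmZ m 1 (A g) - A (XmZ m 1 g)

/-- The generalized binomial coefficient `C(b,j) = b(b−1)⋯(b−j+1)/j!`. -/
noncomputable def bchoose (b : ℂ) (j : ℕ) : ℂ :=
  (∏ i ∈ Finset.range j, (b - (i : ℂ))) / (j.factorial : ℂ)

/-- `Θ_b(u) = Σ_{j≥0} C(b,j) (ad X_m)^j(u) ∘ X_m^{−j}`; for `ad(X_m)`-nilpotent `u`
the family has finite support, so the `finsum` is the honest finite sum. -/
noncomputable def Theta (m : ℤ × ℤ) (b : ℂ) (u : NN m → NN m) : NN m → NN m :=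
  ∑ᶠ j : ℕ, bchoose b j • ((adXm m)^[j] u) ∘ (XmZ m (-1))^[j]

theorem XmZ_add (m : ℤ × ℤ) (j : ℤ) (g h : NN m) : XmZ m j (g + h) = XmZ m j g + XmZ m j h :=
  Finsupp.mapDomain_add

theorem XmZ_zero (m : ℤ × ℤ) (j : ℤ) : XmZ m j 0 = 0 :=
  Finsupp.mapDomain_zero

theorem XmZ_neg (m : ℤ × ℤ) (j : ℤ) (g : NN m) : XmZ m j (-g) = -XmZ m j g :=
  map_neg (Finsupp.mapDomain.addMonoidHom (· + j)) g

theorem XmZ_sub (m : ℤ × ℤ) (j : ℤ) (g h : NN m) : XmZ m j (g - h) = XmZ m j g - XmZ m j h := by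
  rw [sub_eq_add_neg, XmZ_add, XmZ_neg, ← sub_eq_add_neg]

theorem XmZ_smul (m : ℤ × ℤ) (j : ℤ) (c : ℂ) (g : NN m) : XmZ m j (c • g) = c • XmZ m j g :=
  Finsupp.mapDomain_smul c g

theorem XmZ_sum (m : ℤ × ℤ) (j : ℤ) {ι : Type*} (S : Finset ι) (f : ι → NN m) :
    XmZ m j (∑ s ∈ S, f s) = ∑ s ∈ S, XmZ m j (f s) :=
  map_sum (Finsupp.mapDomain.addMonoidHom (· + j)) f S

theorem XmZ_one_neg_one (m : ℤ × ℤ) (g : NN m) : XmZ m 1 (XmZ m (-1) g) = g := by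
  unfold XmZ
  rw [← Finsupp.mapDomain_comp]
  convert Finsupp.mapDomain_id
  ext x
  simp

theorem XmZ_apply (m : ℤ × ℤ) (j : ℤ) (g : NN m) (i : ℤ) : XmZ m j g i = g (i - j) := by
  have h := Finsupp.mapDomain_apply (f := (· + j)) (add_left_injective j) g (i - j)
  simpa [XmZ] using h

theorem Xop_XmZ_one (m k : ℤ × ℤ) (g : NN m) :
    Xop m k (XmZ m 1 g) = XmZ m 1 (Xop m k g) := by
  unfold Xop
  split_ifs with h
  · rfl
  · ext1 i
    simp [XmZ_apply]

theorem Xop_add (m k : ℤ × ℤ) (g h : NN m) : Xop m k (g + h) = Xop m k g + Xop m k h := by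
  unfold Xop
  split_ifs
  · exact XmZ_add m 1 g h
  · ext1 i
    simp [mul_add]

theorem Dop_XmZ_one_of_ne {m s : ℤ × ℤ} (hs : s ≠ m) (g : NN m) :
    Dop m s (XmZ m 1 g) = XmZ m 1 (Dop m s g) := by
  ext1 i
  simp [Dop, hs, XmZ_apply]

theorem Dop_self_XmZ_one (m : ℤ × ℤ) (g : NN m) :
    Dop m m (XmZ m 1 g) = XmZ m 1 (Dop m m g) + g := by
  have hadd : ∀ g h : NN m, Dop m m (g + h) = Dop m m g + Dop m m h := fun g h => by
    simp only [Dop, dite_true]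
    exact Finsupp.sum_add_index' (by simp) (by simp)
  induction g using Finsupp.induction_linear with
  | zero => simp [Dop, XmZ_zero]
  | add f g hf hg => rw [XmZ_add, hadd, hf, hg, hadd, XmZ_add]; abel
  | single k a =>
    simp only [Dop, dite_true, XmZ, Finsupp.mapDomain_single]
    rw [Finsupp.sum_single_index (by simp), Finsupp.sum_single_index (by simp),
      Finsupp.mapDomain_single, add_sub_cancel_right, sub_add_cancel, ← Finsupp.single_add,
      add_smul, one_smul]

theorem nvars_XmZ_one (m : ℤ × ℤ) (g : NN m) : nvars m (XmZ m 1 g) = nvars m g := by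
  unfold nvars
  congr 1
  ext p
  simp only [Finset.mem_biUnion, Finsupp.mem_support_iff, XmZ_apply]
  constructor
  · rintro ⟨i, hi⟩
    exact ⟨i - 1, hi⟩
  · rintro ⟨i, hi⟩
    exact ⟨i + 1, by simpa using hi⟩

/-- The first-order operator `Σ_s f(s) x_{k(s)} ∂_s` on `N`. -/
noncomputable def firstOrderOp (m : ℤ × ℤ) (f : ℤ × ℤ → ℂ) (k : ℤ × ℤ → ℤ × ℤ) (g : NN m) :
    NN m :=
  ∑ s ∈ nvars m g, f s • Xop m (k s) (Dop m s g)

theorem firstOrderOp_XmZ_one (m : ℤ × ℤ) (f : ℤ × ℤ → ℂ) (k : ℤ × ℤ → ℤ × ℤ) (g : NN m) :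
    firstOrderOp m f k (XmZ m 1 g) = XmZ m 1 (firstOrderOp m f k g) + f m • Xop m (k m) g := by
  have hm : m ∈ nvars m g := Finset.mem_insert_self _ _
  unfold firstOrderOp
  rw [nvars_XmZ_one, XmZ_sum, ← Finset.add_sum_erase _ _ hm, ← Finset.add_sum_erase _ _ hm,
    Finset.sum_congr rfl fun s hs => by
      rw [Dop_XmZ_one_of_ne (Finset.ne_of_mem_erase hs), Xop_XmZ_one, ← XmZ_smul],
    Dop_self_XmZ_one, Xop_add, Xop_XmZ_one, smul_add, XmZ_smul]
  abel

theorem adXm_firstOrderOp (m : ℤ × ℤ) (f : ℤ × ℤ → ℂ) (k : ℤ × ℤ → ℤ × ℤ) :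
    adXm m (firstOrderOp m f k) = fun g => (-f m) • Xop m (k m) g := by
  funext g
  rw [adXm, firstOrderOp_XmZ_one, neg_smul]
  abel

theorem adXm_smul_Xop (m k : ℤ × ℤ) (c : ℂ) : adXm m (fun g => c • Xop m k g) = 0 := by
  funext g
  simp [adXm, Xop_XmZ_one, XmZ_smul]

theorem iterate_adXm_zero (m : ℤ × ℤ) (j : ℕ) : (adXm m)^[j] 0 = 0 :=
  Function.iterate_fixed (by funext g; simp [adXm, XmZ_zero]) j

theorem Theta_of_adXm_eq {m k : ℤ × ℤ} {c : ℂ} {u : NN m → NN m}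
    (hu : adXm m u = fun g => c • Xop m k g) (b : ℂ) :
    Theta m b u = fun g => u g + (b * c) • Xop m k (XmZ m (-1) g) := by
  have hsupp : (Function.support fun j : ℕ =>
      bchoose b j • ((adXm m)^[j] u) ∘ (XmZ m (-1))^[j]) ⊆ (Finset.range 2 : Finset ℕ) := by
    intro j hj
    by_contra hlt
    obtain ⟨i, rfl⟩ := Nat.exists_eq_add_of_le' (not_lt.1 (mt Finset.mem_range.2 hlt))
    refine hj ?_
    funext g
    simp [Function.iterate_add_apply, hu, adXm_smul_Xop, iterate_adXm_zero]
  funext g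
  rw [Theta, finsum_eq_sum_of_support_subset _ hsupp]
  simp [Finset.sum_range_succ, bchoose, hu, smul_smul]

/-- the formulas for `Θ_b(E11(n))`, `Θ_b(E22(n))`, `Θ_b(D1)`, `Θ_b(D2)`. -/
theorem stmt5 (q μ : ℂ) (hq : q ≠ 0) (m : ℤ × ℤ) (b : ℂ) (n : ℤ × ℤ) :
    (Theta m b (E11N q μ m n) = fun g =>
      E11N q μ m n g + (b * q ^ (m.2 * n.1)) • Xop m (m + n) (XmZ m (-1) g)) ∧
    (Theta m b (E22N q m n) = fun g =>
      E22N q m n g - (b * q ^ (m.1 * n.2)) • Xop m (m + n) (XmZ m (-1) g)) ∧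
    (Theta m b (D1N m) = fun g => D1N m g - (b * (m.1 : ℂ)) • g) ∧
    (Theta m b (D2N m) = fun g => D2N m g - (b * (m.2 : ℂ)) • g) := by
  have hE22 : E22N q m n = firstOrderOp m (fun s => q ^ (s.1 * n.2)) (n + ·) := rfl
  have hD1 : D1N m = firstOrderOp m (fun s => (s.1 : ℂ)) id := rfl
  have hD2 : D2N m = firstOrderOp m (fun s => (s.2 : ℂ)) id := rfl
  have hE11 : adXm m (E11N q μ m n) = fun g => q ^ (m.2 * n.1) • Xop m (m + n) g := by
    funext g
    have h := firstOrderOp_XmZ_one m (fun s => q ^ (s.2 * n.1)) (n + ·) g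
    simp only [firstOrderOp] at h
    simp only [adXm, E11N, XmZ_sub, h, add_comm m n]
    split_ifs
    · rw [XmZ_smul]
      abel
    · rw [XmZ_zero]
      abel
  have hX : ∀ g, Xop m m (XmZ m (-1) g) = g := fun g => by
    simp [Xop, XmZ_one_neg_one]
  refine ⟨Theta_of_adXm_eq hE11 b, ?_, ?_, ?_⟩
  · rw [hE22, Theta_of_adXm_eq (adXm_firstOrderOp ..)]
    funext g
    rw [mul_neg, neg_smul, ← sub_eq_add_neg, add_comm m n]
  · rw [hD1, Theta_of_adXm_eq (adXm_firstOrderOp ..)]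
    funext g
    rw [mul_neg, neg_smul, ← sub_eq_add_neg, id, hX]
  · rw [hD2, Theta_of_adXm_eq (adXm_firstOrderOp ..)]
    funext g
    rw [mul_neg, neg_smul, ← sub_eq_add_neg, id, hX]
end

section
/- Assume μ ∉ ℤ. Then the smallest subspace of the quotient Q = N/P that contains the class of x_m^{−1} and is invariant under all induced operators E_{ij}(n) (i,j ∈ {1,2}, n ∈ ℤ²), D1, D2 is Q itself. -/
open MvPolynomial Finsupp

/-- The copy of `P = ℂ[x_n : n ∈ ℤ²]` inside `N`: the elements with no negative
powers of `x_m`. -/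
noncomputable def PinN (m : ℤ × ℤ) : Submodule ℂ (NN m) where
  carrier := {g | ∀ k : ℤ, k < 0 → g k = 0}
  zero_mem' := fun _ _ => rfl
  add_mem' := fun {a b} ha hb k hk => by
    simp [Finsupp.add_apply, ha k hk, hb k hk]
  smul_mem' := fun c g hg k hk => by
    simp [Finsupp.smul_apply, hg k hk]

lemma Xop_self_single (m : ℤ × ℤ) (k : ℤ) (a : MvPolynomial (NVar m) ℂ) :
    Xop m m (Finsupp.single k a) = Finsupp.single (k + 1) a := by
  simp [Xop, XmZ, Finsupp.mapDomain_single]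

lemma Xop_of_ne_single {m n : ℤ × ℤ} (h : n ≠ m) (k : ℤ) (a : MvPolynomial (NVar m) ℂ) :
    Xop m n (Finsupp.single k a) = Finsupp.single k (X (⟨n, h⟩ : NVar m) * a) := by
  simp [Xop, h, Finsupp.mapRange_single]

lemma Dop_self_single (m : ℤ × ℤ) (k : ℤ) (a : MvPolynomial (NVar m) ℂ) :
    Dop m m (Finsupp.single k a) = Finsupp.single (k - 1) (k • a) := by
  simp [Dop]

lemma nvars_single_one (m : ℤ × ℤ) (k : ℤ) :
    nvars m (Finsupp.single k 1) = {m} := by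
  rw [nvars, Finsupp.support_single k one_ne_zero]
  simp

/-- `E12(−m)` lowers the exponent of a power of `x_m` by one. -/
lemma E12N_neg_single_one (q μ : ℂ) (m : ℤ × ℤ) (k : ℤ) :
    E12N q μ m (-m) (Finsupp.single k 1) =
      (q ^ (-(m.1 * m.2)) * (k * (μ - (k - 1)))) • Finsupp.single (k - 1) 1 := by
  have hexp : (-m).2 * m.1 + m.2 * (-m).1 + m.2 * m.1 = -(m.1 * m.2) := by
    simp only [Prod.fst_neg, Prod.snd_neg]; ring
  have hexp' : -((-m).1 * (-m).2) = -(m.1 * m.2) := by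
    simp only [Prod.fst_neg, Prod.snd_neg]; ring
  rw [E12N, nvars_single_one, Finset.sum_singleton, Finset.sum_singleton, hexp, hexp', neg_neg,
    neg_add_cancel, zero_add, Dop_self_single, Dop_self_single, Xop_self_single, sub_add_cancel]
  simp only [Finsupp.smul_single, ← Finsupp.single_sub, ← Int.cast_smul_eq_zsmul ℂ, smul_smul,
    ← sub_smul]
  congr 2
  push_cast
  ring

/-- A subspace stable under all `x_n`, `n ≠ m`, and containing `x_m^k` contains
`x_m^k ℂ[x_n : n ≠ m]`. -/
lemma single_mem_of_single_one_mem {m : ℤ × ℤ} {W : Submodule ℂ (NN m)}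
    (hX : ∀ n, ∀ g ∈ W, Xop m n g ∈ W) {k : ℤ} (hk : Finsupp.single k 1 ∈ W)
    (a : MvPolynomial (NVar m) ℂ) : Finsupp.single k a ∈ W := by
  induction a using MvPolynomial.induction_on with
  | C c =>
    have h := W.smul_mem c hk
    rwa [Finsupp.smul_single, ← MvPolynomial.C_mul', mul_one] at h
  | add p r hp hr => rw [Finsupp.single_add]; exact W.add_mem hp hr
  | mul_X p n hp =>
    have h := hX n.1 _ hp
    rwa [Xop_of_ne_single n.2, mul_comm] at h

/-- if `μ ∉ ℤ`, then the smallest subspace of `Q = N/P` containing the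
class of `x_m^{−1}` and invariant under all induced operators is `Q` itself.
(Subspaces of `N/P` correspond to submodules `W` of `N` with `P ≤ W`; the class of
`x_m^{−1}` lies in `W/P` iff `x_m^{−1} ∈ W`, invariance of `W/P` under the induced
operators is invariance of `W`, and `W/P = Q` iff `W = ⊤`.) -/
theorem stmt11 (q μ : ℂ) (hq : q ≠ 0) (m : ℤ × ℤ) (hμ : ∀ z : ℤ, μ ≠ (z : ℂ)) :
    ∀ W : Submodule ℂ (NN m), PinN m ≤ W →
      Finsupp.single (-1 : ℤ) 1 ∈ W →
      (∀ (n : ℤ × ℤ) (g : NN m), g ∈ W →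
        E11N q μ m n g ∈ W ∧ E12N q μ m n g ∈ W ∧ E21N m n g ∈ W ∧ E22N q m n g ∈ W) →
      (∀ g ∈ W, D1N m g ∈ W ∧ D2N m g ∈ W) →
      W = ⊤ := by
  intro W hP hneg hE _
  have hpow : ∀ k : ℤ, k ≤ -1 → Finsupp.single k 1 ∈ W := by
    refine fun k hk => Int.leInductionDown (motive := fun k _ => Finsupp.single k 1 ∈ W)
      hneg (fun k hk ih => ?_) k hk
    have h := (hE (-m) _ ih).2.1
    rw [E12N_neg_single_one] at h
    refine (W.smul_mem_iff ?_).1 h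
    have hk0 : (k : ℂ) ≠ 0 := by exact_mod_cast (by omega : k ≠ 0)
    have hμk : μ - (k - 1) ≠ 0 := sub_ne_zero.2 (by exact_mod_cast hμ (k - 1))
    exact mul_ne_zero (zpow_ne_zero _ hq) (mul_ne_zero hk0 hμk)
  refine eq_top_iff.2 fun g _ => ?_
  rw [← Finsupp.sum_single g]
  refine W.sum_mem fun k _ => ?_
  rcases lt_or_ge k 0 with hk | hk
  · exact single_mem_of_single_one_mem (fun n g hg => (hE n g hg).2.2.1) (hpow k (by omega)) _
  · exact hP fun j hj => Finsupp.single_eq_of_ne (by omega)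
end
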